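/- Let (X,d) be a metric space and f : X → X a chain transitive homeomorphism. If f has the 𝒯₀-inverse shadowing property, then both the system (X,f) and the inverse system (X, f⁻¹) are equicontinuous. -/

import Mathlib

variable {X : Type*} [MetricSpace X]

/-- `φ` is a `δ`-method for the homeomorphism `f`. -/
def IsMethod (f : X ≃ X) (δ : ℝ) (φ : X → ℤ → X) : Prop :=
  ∀ x : X, φ x 0 = x ∧ ∀ k : ℤ, dist (f (φ x k)) (φ x (k + 1)) < δ

/-- `f` has `𝒯₀`-inverse shadowing. -/
def InverseShadowing (f : X ≃ X) : Prop :=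
  ∀ ε > (0 : ℝ), ∃ δ > (0 : ℝ), ∀ x : X, ∀ φ : X → ℤ → X, IsMethod f δ φ →
    ∃ y : X, ∀ k : ℤ, dist (φ y k) ((f ^ k) x) < ε

/-- `g` is chain transitive. -/
def ChainTransitive (g : X → X) : Prop :=
  ∀ a b : X, ∀ δ > (0 : ℝ), ∃ m : ℕ, 1 ≤ m ∧ ∃ z : ℕ → X, z 0 = a ∧ z m = b ∧
    ∀ i < m, dist (g (z i)) (z (i + 1)) < δ

/-- The system `(X, g)` is equicontinuous. -/
def EquicontinuousSystem (g : X → X) : Prop :=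
  ∀ x : X, ∀ ε > (0 : ℝ), ∃ η > (0 : ℝ), ∀ y : X, dist x y < η →
    ∀ n : ℕ, dist (g^[n] x) (g^[n] y) < ε

/-- Inverse shadowing yields, for each orbit, a point all of whose pseudo-orbits follow it. -/
lemma InverseShadowing.exists_forall_pseudoOrbit {f : X ≃ X} (h : InverseShadowing f)
    {ε : ℝ} (hε : 0 < ε) : ∃ δ > (0 : ℝ), ∀ x : X, ∃ y : X, ∀ s : ℤ → X, s 0 = y →
      (∀ k, dist (f (s k)) (s (k + 1)) < δ) → ∀ k, dist (s k) ((f ^ k) x) < ε := by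
  obtain ⟨δ, hδ, H⟩ := h ε hε
  refine ⟨δ, hδ, fun x => ?_⟩
  by_contra! hc
  choose φ hφ0 hφ1 k hk using hc
  obtain ⟨y, hy⟩ := H x φ fun y => ⟨hφ0 y, hφ1 y⟩
  exact (hk y).not_gt (hy (k y))

/-- Extend the chain `z 0, …, z m` to a bi-infinite sequence by true orbits on both sides. -/
def extendChain {Y : Type*} (f : Y ≃ Y) (z : ℕ → Y) (m : ℕ) (k : ℤ) : Y :=
  ((f : Equiv.Perm Y) ^ (k - (min k.toNat m : ℕ))) (z (min k.toNat m))

lemma extendChain_of_nonpos {Y : Type*} (f : Y ≃ Y) (z : ℕ → Y) (m : ℕ) {k : ℤ} (hk : k ≤ 0) :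
    extendChain f z m k = ((f : Equiv.Perm Y) ^ k) (z 0) := by
  have : min k.toNat m = 0 := by omega
  simp [extendChain, this]

lemma extendChain_of_ge {Y : Type*} (f : Y ≃ Y) (z : ℕ → Y) (m : ℕ) {k : ℤ} (hk : m ≤ k) :
    extendChain f z m k = ((f : Equiv.Perm Y) ^ (k - m)) (z m) := by
  have : min k.toNat m = m := by omega
  simp only [extendChain, this]

lemma extendChain_natCast {Y : Type*} (f : Y ≃ Y) (z : ℕ → Y) {m k : ℕ} (hk : k ≤ m) :
    extendChain f z m k = z k := by
  simp [extendChain, min_eq_left hk]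

lemma dist_extendChain_lt {f : X ≃ X} {z : ℕ → X} {m : ℕ} {δ : ℝ} (hδ : 0 < δ)
    (hz : ∀ i < m, dist (f (z i)) (z (i + 1)) < δ) (k : ℤ) :
    dist (f (extendChain f z m k)) (extendChain f z m (k + 1)) < δ := by
  rcases lt_or_ge k 0 with hk | hk
  · rw [extendChain_of_nonpos f z m hk.le, extendChain_of_nonpos f z m (by omega : k + 1 ≤ 0),
      add_comm, zpow_one_add, Equiv.Perm.mul_apply, dist_self]
    exact hδ
  · lift k to ℕ using hk
    rcases lt_or_ge k m with hkm | hkm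
    · have := extendChain_natCast f z (Nat.succ_le_of_lt hkm)
      rw [Nat.cast_succ] at this
      rw [this, extendChain_natCast f z hkm.le]
      exact hz k hkm
    · rw [extendChain_of_ge f z m (by omega : (m : ℤ) ≤ k),
        extendChain_of_ge f z m (by omega : (m : ℤ) ≤ k + 1),
        show (k : ℤ) + 1 - m = 1 + (k - m) by ring, zpow_one_add, Equiv.Perm.mul_apply, dist_self]
      exact hδ

lemma InverseShadowing.equicontinuousSystem {f : X ≃ X} (hct : ChainTransitive f)
    (h : InverseShadowing f) : EquicontinuousSystem f := by
  intro a ε hε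
  obtain ⟨δ, hδ, H⟩ := h.exists_forall_pseudoOrbit (half_pos hε)
  obtain ⟨y, hy⟩ := H a
  obtain ⟨m, hm, z, hz0, hzm, hz⟩ := hct y a δ hδ
  have hlast : dist (f (z (m - 1))) a < δ := by
    have := hz (m - 1) (by omega)
    rwa [Nat.sub_add_cancel hm, hzm] at this
  have key : ∀ b, dist a b < δ - dist (f (z (m - 1))) a → ∀ n : ℕ,
      dist (f^[n] b) (((f : Equiv.Perm X) ^ ((m : ℤ) + n)) a) < ε / 2 := by
    intro b hb n
    have hs := hy (extendChain f (Function.update z m b) m)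
      (by rw [extendChain_of_nonpos _ _ _ le_rfl, Function.update_of_ne (by omega)]; simpa using hz0)
      (dist_extendChain_lt hδ fun i hi => ?_) (m + n)
    · rw [extendChain_of_ge _ _ _ (by omega), add_sub_cancel_left, Function.update_self,
        zpow_natCast, ← Equiv.Perm.iterate_eq_pow] at hs
      exact hs
    · rw [Function.update_of_ne hi.ne]
      rcases eq_or_ne (i + 1) m with rfl | hne
      · rw [Function.update_self]
        rw [Nat.add_sub_cancel] at hb
        linarith [dist_triangle (f (z i)) a b]
      · rw [Function.update_of_ne hne]
        exact hz i hi
  refine ⟨δ - dist (f (z (m - 1))) a, sub_pos.2 hlast, fun b hb n => ?_⟩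
  exact (dist_triangle_right _ _ _).trans_lt
    ((add_lt_add (key a (by simpa using hlast) n) (key b hb n)).trans_eq (add_halves ε))

lemma InverseShadowing.equicontinuousSystem_symm {f : X ≃ X} (hf : Continuous f)
    (hct : ChainTransitive f) (h : InverseShadowing f) : EquicontinuousSystem f.symm := by
  intro a ε hε
  obtain ⟨δ, hδ, H⟩ := h.exists_forall_pseudoOrbit (half_pos hε)
  obtain ⟨y, hy⟩ := H a
  obtain ⟨m, hm, z, hz0, hzm, hz⟩ := hct a y δ hδ
  have hfirst : dist (f a) (z 1) < δ := by simpa [hz0] using hz 0 (by omega)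
  obtain ⟨η, hη, hball⟩ := Metric.continuous_iff.1 hf a (δ - dist (f a) (z 1)) (sub_pos.2 hfirst)
  have key : ∀ b, dist a b < η → ∀ n : ℕ,
      dist (f.symm^[n] b) (((f : Equiv.Perm X) ^ (-(m : ℤ) - n)) a) < ε / 2 := by
    intro b hb n
    have hs := hy (fun k => extendChain f (Function.update z 0 b) m (k + m))
      (by
        simp only [zero_add]
        rw [extendChain_natCast _ _ le_rfl, Function.update_of_ne (by omega), hzm])
      (fun k => ?_) (-m - n)
    · simp only [show (-(m : ℤ) - n) + m = -n by ring] at hs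
      rw [extendChain_of_nonpos _ _ _ (by omega), Function.update_self,
        zpow_neg, zpow_natCast, ← inv_pow, ← Equiv.Perm.iterate_eq_pow] at hs
      exact hs
    · simp only [add_right_comm k 1 (m : ℤ)]
      refine dist_extendChain_lt hδ (fun i hi => ?_) (k + m)
      rw [Function.update_of_ne (Nat.succ_ne_zero i)]
      rcases eq_or_ne i 0 with rfl | hne
      · rw [Function.update_self]
        linarith [dist_triangle (f b) (f a) (z 1), hball b (by rwa [dist_comm])]
      · rw [Function.update_of_ne hne]
        exact hz i hi
  refine ⟨η, hη, fun b hb n => ?_⟩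
  exact (dist_triangle_right _ _ _).trans_lt
    ((add_lt_add (key a (by simpa using hη) n) (key b hb n)).trans_eq (add_halves ε))

theorem stmt_12 (f : X ≃ X) (hf : Continuous f) (hf' : Continuous f.symm)
    (hct : ChainTransitive (⇑f)) (h : InverseShadowing f) :
    EquicontinuousSystem (⇑f) ∧ EquicontinuousSystem (⇑f.symm) :=
  ⟨h.equicontinuousSystem hct, h.equicontinuousSystem_symm hf hct⟩
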